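/- arXiv:1405.3359 — 4 statements merged into one kernel-verified Lean document; each statement's English description precedes it below -/
import Mathlib

section
/- (Bihari's inequality) Let T > 0, u₀ > 0, and let u, v : [0,T] → ℝ be continuous with u(t) ≥ 0 and v(t) ≥ 0 for all t ∈ [0,T]. Let κ : [0,∞) → [0,∞) be continuous, nondecreasing, concave on [0,∞), with κ(q) > 0 for q > 0. If u(t) ≤ u₀ + ∫₀ᵗ v(s)·κ(u(s)) ds for all t ∈ [0,T], then for every t ∈ [0,T] and every w > 0 satisfying G(w) = G(u₀) + ∫₀ᵗ v(s) ds, one has u(t) ≤ w; equivalently, u(t) ≤ G⁻¹(G(u₀) + ∫₀ᵗ v(s) ds) whenever G(u₀) + ∫₀ᵗ v(s) ds lies in the domain of G⁻¹. -/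
open Set MeasureTheory intervalIntegral

lemma ContinuousOn.hasDerivAt_integral_of_mem_Ioo {f : ℝ → ℝ} {a b c x : ℝ}
    (hf : ContinuousOn f (Ioo a b)) (hx : x ∈ Ioo a b)
    (hint : IntervalIntegrable f volume c x) :
    HasDerivAt (fun y ↦ ∫ s in c..y, f s) (f x) x :=
  integral_hasDerivAt_right hint (hf.stronglyMeasurableAtFilter isOpen_Ioo x hx)
    (hf.continuousAt (isOpen_Ioo.mem_nhds hx))

lemma ContinuousOn.intervalIntegrable_of_pos {f : ℝ → ℝ} (hf : ContinuousOn f (Ioi 0))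
    {a b : ℝ} (ha : 0 < a) (hb : 0 < b) : IntervalIntegrable f volume a b :=
  (hf.mono fun _ hx ↦ lt_of_lt_of_le (lt_min ha hb) hx.1).intervalIntegrable

/-- **Bihari's inequality.** If `u(t) ≤ u₀ + ∫₀ᵗ v(s) κ(u(s)) ds` on `[0,T]`,
then `u(t) ≤ w` for every `w > 0` with `G(w) = G(u₀) + ∫₀ᵗ v(s) ds`,
where `G(q) = ∫₁^q ds / κ(s)`. -/
theorem bihari_inequality
    (T u₀ : ℝ) (hT : 0 < T) (hu₀ : 0 < u₀)
    (u v : ℝ → ℝ)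
    (hu_cont : ContinuousOn u (Icc 0 T))
    (hv_cont : ContinuousOn v (Icc 0 T))
    (hu_nonneg : ∀ t ∈ Icc (0 : ℝ) T, 0 ≤ u t)
    (hv_nonneg : ∀ t ∈ Icc (0 : ℝ) T, 0 ≤ v t)
    (κ : ℝ → ℝ)
    (hκ_cont : ContinuousOn κ (Ici 0))
    (hκ_mono : MonotoneOn κ (Ici 0))
    (hκ_concave : ConcaveOn ℝ (Ici 0) κ)
    (hκ_nonneg : ∀ q ∈ Ici (0 : ℝ), 0 ≤ κ q)
    (hκ_pos : ∀ q > (0 : ℝ), 0 < κ q)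
    (hmain : ∀ t ∈ Icc (0 : ℝ) T, u t ≤ u₀ + ∫ s in (0 : ℝ)..t, v s * κ (u s)) :
    ∀ t ∈ Icc (0 : ℝ) T, ∀ w > (0 : ℝ),
      (∫ s in (1 : ℝ)..w, 1 / κ s) =
        (∫ s in (1 : ℝ)..u₀, 1 / κ s) + (∫ s in (0 : ℝ)..t, v s) →
      u t ≤ w := by
  have hf_cont : ContinuousOn (fun s ↦ v s * κ (u s)) (Icc 0 T) :=
    hv_cont.mul (hκ_cont.comp hu_cont hu_nonneg)
  have hg_cont : ContinuousOn (fun s ↦ 1 / κ s) (Ioi 0) :=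
    continuousOn_const.div (hκ_cont.mono Ioi_subset_Ici_self) fun s hs ↦ (hκ_pos s hs).ne'
  have hint {f : ℝ → ℝ} (hf : ContinuousOn f (Icc 0 T)) {t : ℝ} (ht : t ∈ Icc 0 T) :
      IntervalIntegrable f volume 0 t :=
    (hf.mono (Icc_subset_Icc_right ht.2)).intervalIntegrable_of_Icc ht.1
  have hprim {f : ℝ → ℝ} (hf : ContinuousOn f (Icc 0 T)) :
      ContinuousOn (fun t ↦ ∫ s in (0 : ℝ)..t, f s) (Icc 0 T) := by
    rw [← uIcc_of_le hT.le] at hf ⊢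
    exact continuousOn_primitive_interval (hf.integrableOn_compact isCompact_uIcc)
  set R : ℝ → ℝ := fun t ↦ u₀ + ∫ s in (0 : ℝ)..t, v s * κ (u s) with hR
  have hR_cont : ContinuousOn R (Icc 0 T) := continuousOn_const.add (hprim hf_cont)
  have hR_pos : ∀ t ∈ Icc 0 T, 0 < R t := fun t ht ↦
    add_pos_of_pos_of_nonneg hu₀ <| integral_nonneg ht.1 fun s hs ↦
      have hs' : s ∈ Icc 0 T := ⟨hs.1, hs.2.trans ht.2⟩
      mul_nonneg (hv_nonneg s hs') (hκ_nonneg _ (hu_nonneg s hs'))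
  have hG_deriv : ∀ q > 0, HasDerivAt (fun y ↦ ∫ s in (1 : ℝ)..y, 1 / κ s) (1 / κ q) q :=
    fun q hq ↦ (hg_cont.mono fun _ hx ↦ hx.1).hasDerivAt_integral_of_mem_Ioo
      (b := q + 1) ⟨hq, lt_add_one q⟩ (hg_cont.intervalIntegrable_of_pos one_pos hq)
  have hanti : AntitoneOn
      (fun t ↦ (∫ s in (1 : ℝ)..R t, 1 / κ s) - ∫ s in (0 : ℝ)..t, v s) (Icc 0 T) := by
    have hderiv : ∀ t ∈ Ioo 0 T, HasDerivAt
        (fun t ↦ (∫ s in (1 : ℝ)..R t, 1 / κ s) - ∫ s in (0 : ℝ)..t, v s)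
        (1 / κ (R t) * (v t * κ (u t)) - v t) t := by
      intro t ht
      have ht' := Ioo_subset_Icc_self ht
      have hR_deriv : HasDerivAt R (v t * κ (u t)) t :=
        ((hf_cont.mono Ioo_subset_Icc_self).hasDerivAt_integral_of_mem_Ioo ht
          (hint hf_cont ht')).const_add u₀
      exact ((hG_deriv _ (hR_pos t ht')).comp t hR_deriv).sub
        ((hv_cont.mono Ioo_subset_Icc_self).hasDerivAt_integral_of_mem_Ioo ht (hint hv_cont ht'))
    refine antitoneOn_of_deriv_nonpos (convex_Icc 0 T) ?_ ?_ ?_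
    · refine ContinuousOn.sub (fun t ht ↦ ?_) (hprim hv_cont)
      exact (hG_deriv _ (hR_pos t ht)).continuousAt.comp_continuousWithinAt (hR_cont t ht)
    · rw [interior_Icc]
      exact fun t ht ↦ (hderiv t ht).differentiableAt.differentiableWithinAt
    · rw [interior_Icc]
      intro t ht
      have ht' := Ioo_subset_Icc_self ht
      have hκR := hκ_pos _ (hR_pos t ht')
      have hκu : κ (u t) ≤ κ (R t) :=
        hκ_mono (hu_nonneg t ht') (hR_pos t ht').le (hmain t ht')
      rw [(hderiv t ht).deriv, sub_nonpos, one_div_mul_eq_div, div_le_iff₀ hκR]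
      exact mul_le_mul_of_nonneg_left hκu (hv_nonneg t ht')
  intro t ht w hw hGw
  refine (hmain t ht).trans (le_of_not_gt fun hlt ↦ ?_)
  have hle := hanti (left_mem_Icc.2 hT.le) ht ht.1
  have hpos : 0 < ∫ s in w..R t, 1 / κ s :=
    intervalIntegral_pos_of_pos_on (hg_cont.intervalIntegrable_of_pos hw (hR_pos t ht))
      (fun s hs ↦ one_div_pos.2 (hκ_pos s (hw.trans hs.1))) hlt
  have hsplit := integral_add_adjacent_intervals
    (hg_cont.intervalIntegrable_of_pos one_pos hw)
    (hg_cont.intervalIntegrable_of_pos hw (hR_pos t ht))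
  have hR0 : R 0 = u₀ := by simp [hR]
  simp only [hR0, integral_same, sub_zero] at hle
  linarith
end

section
/- Let T > 0, ε > 0, and 0 ≤ u₀ < ε. Let u, v : [0,T] → ℝ be continuous with u(t) ≥ 0 and v(t) ≥ 0 for all t ∈ [0,T], and let κ : [0,∞) → [0,∞) be continuous, nondecreasing, concave on [0,∞), with κ(q) > 0 for q > 0. Suppose u(t) ≤ u₀ + ∫₀ᵗ v(s)·κ(u(s)) ds for all t ∈ [0,T], and that ∫₀ᵀ v(s) ds ≤ ∫ over (u₀, ε) of dq/κ(q) (the latter taken as an extended real number, possibly +∞). Then u(t) ≤ ε for all t ∈ [0,T]. -/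
open Set MeasureTheory intervalIntegral

/-- The primitive of a function continuous on `[a, b]` has the expected derivative on `(a, b)`. -/
lemma hasDerivAt_primitive_of_continuousOn_Icc {f : ℝ → ℝ} {a b t : ℝ}
    (hf : ContinuousOn f (Icc a b)) (ht : t ∈ Ioo a b) :
    HasDerivAt (fun x => ∫ s in a..x, f s) (f t) t := by
  have hsub : Icc a t ⊆ Icc a b := Icc_subset_Icc_right ht.2.le
  refine integral_hasDerivAt_right ?_ ?_ (hf.continuousAt (Icc_mem_nhds ht.1 ht.2))
  · exact (hf.mono hsub).intervalIntegrable_of_Icc ht.1.le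
  · exact (hf.mono Ioo_subset_Icc_self).stronglyMeasurableAtFilter isOpen_Ioo t ht

lemma continuousOn_primitive_of_continuousOn_Icc {f : ℝ → ℝ} {a b : ℝ} (hab : a ≤ b)
    (hf : ContinuousOn f (Icc a b)) :
    ContinuousOn (fun x => ∫ s in a..x, f s) (Icc a b) := by
  have h := continuousOn_primitive_interval (μ := volume) (f := f) (a := a) (b := b)
    (by rw [uIcc_of_le hab]; exact hf.integrableOn_Icc)
  rwa [uIcc_of_le hab] at h

lemma monotoneOn_primitive_of_nonneg {f : ℝ → ℝ} {a b : ℝ} (hab : a ≤ b)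
    (hf : ContinuousOn f (Icc a b)) (hnonneg : ∀ t ∈ Icc a b, 0 ≤ f t) :
    MonotoneOn (fun x => ∫ s in a..x, f s) (Icc a b) := by
  refine monotoneOn_of_hasDerivWithinAt_nonneg (f' := f) (convex_Icc a b)
    (continuousOn_primitive_of_continuousOn_Icc hab hf) (fun t ht => ?_) (fun t ht => ?_)
  · rw [interior_Icc] at ht
    exact (hasDerivAt_primitive_of_continuousOn_Icc hf ht).hasDerivWithinAt
  · exact hnonneg t (interior_subset ht)

/-- The separation-of-variables estimate: if `R' ≤ v · κ(R)` and `R` stays positive, then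
`∫ dq / κ(q)` between the end values of `R` is at most `∫ v`. -/
lemma integral_one_div_le_of_hasDerivAt_le {R R' V v κ : ℝ → ℝ} {s t : ℝ} (hst : s ≤ t)
    (hR : ContinuousOn R (Icc s t)) (hV : ContinuousOn V (Icc s t))
    (hR' : ∀ x ∈ Ioo s t, HasDerivAt R (R' x) x) (hV' : ∀ x ∈ Ioo s t, HasDerivAt V (v x) x)
    (hκ : ContinuousOn κ (Ioi 0)) (hκ_pos : ∀ q > (0 : ℝ), 0 < κ q)
    (hR_pos : ∀ x ∈ Icc s t, 0 < R x) (hle : ∀ x ∈ Ioo s t, R' x ≤ v x * κ (R x)) :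
    ∫ q in (R s)..(R t), 1 / κ q ≤ V t - V s := by
  have hcont : ContinuousOn (fun q => 1 / κ q) (Ioi 0) :=
    continuousOn_const.div hκ fun q hq => (hκ_pos q hq).ne'
  have hs : 0 < R s := hR_pos s (left_mem_Icc.2 hst)
  have hF : ∀ x > (0 : ℝ), HasDerivAt (fun y => ∫ q in (R s)..y, 1 / κ q) (1 / κ x) x := by
    intro x hx
    refine integral_hasDerivAt_right ?_ ?_ (hcont.continuousAt (Ioi_mem_nhds hx))
    · refine (hcont.mono fun y hy => ?_).intervalIntegrable
      exact (lt_min hs hx).trans_le hy.1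
    · exact hcont.stronglyMeasurableAtFilter isOpen_Ioi x hx
  have hmono : MonotoneOn (fun x => V x - ∫ q in (R s)..(R x), 1 / κ q) (Icc s t) := by
    refine monotoneOn_of_hasDerivWithinAt_nonneg (f' := fun x => v x - 1 / κ (R x) * R' x)
      (convex_Icc s t) (hV.sub ?_) (fun x hx => ?_) (fun x hx => ?_)
    · intro x hx
      exact (hF (R x) (hR_pos x hx)).continuousAt.comp_continuousWithinAt (hR x hx)
    · rw [interior_Icc] at hx
      exact ((hV' x hx).sub ((hF (R x) (hR_pos x (Ioo_subset_Icc_self hx))).comp x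
        (hR' x hx))).hasDerivWithinAt
    · rw [interior_Icc] at hx
      have hk := hκ_pos _ (hR_pos x (Ioo_subset_Icc_self hx))
      rw [sub_nonneg, one_div_mul_eq_div, div_le_iff₀ hk]
      exact hle x hx
  have h := hmono (left_mem_Icc.2 hst) (right_mem_Icc.2 hst) hst
  simp only [integral_same] at h
  linarith

/-- A bound on the Lebesgue integral over all `(c, b]` with `a < c < b` passes to `(a, b)`. -/
lemma setLIntegral_Ioo_le_of_forall_Ioc_le {f : ℝ → ENNReal} {a b : ℝ} {C : ENNReal}
    (hab : a < b) (h : ∀ c ∈ Ioo a b, ∫⁻ q in Ioc c b, f q ≤ C) :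
    ∫⁻ q in Ioo a b, f q ≤ C := by
  obtain ⟨c, hc_anti, hc_mem, hc_lim⟩ := exists_seq_strictAnti_tendsto' hab
  have hsub : Ioo a b ⊆ ⋃ n, Ioc (c n) b := by
    intro q hq
    obtain ⟨n, hn⟩ := (hc_lim.eventually (gt_mem_nhds hq.1)).exists
    exact mem_iUnion.2 ⟨n, hn, hq.2.le⟩
  have hdir : Directed (· ⊆ ·) fun n => Ioc (c n) b :=
    Monotone.directed_le fun m n hmn => Ioc_subset_Ioc_left (hc_anti.antitone hmn)
  calc ∫⁻ q in Ioo a b, f q ≤ ∫⁻ q in ⋃ n, Ioc (c n) b, f q := lintegral_mono_set hsub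
    _ = ⨆ n, ∫⁻ q in Ioc (c n) b, f q := setLIntegral_iUnion_of_directed f hdir
    _ ≤ C := iSup_le fun n => h (c n) (hc_mem n)

/-- If `u(t) ≤ u₀ + ∫₀ᵗ v(s) κ(u(s)) ds` on `[0,T]` with `0 ≤ u₀ < ε`, and
`∫₀ᵀ v(s) ds ≤ ∫_{(u₀,ε)} dq / κ(q)` (the latter a possibly infinite Lebesgue
integral), then `u(t) ≤ ε` for all `t ∈ [0,T]`. -/
theorem bihari_bound_of_small_initial
    (T ε u₀ : ℝ) (hT : 0 < T) (hε : 0 < ε) (hu₀_nonneg : 0 ≤ u₀) (hu₀ : u₀ < ε)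
    (u v : ℝ → ℝ)
    (hu_cont : ContinuousOn u (Icc 0 T))
    (hv_cont : ContinuousOn v (Icc 0 T))
    (hu_nonneg : ∀ t ∈ Icc (0 : ℝ) T, 0 ≤ u t)
    (hv_nonneg : ∀ t ∈ Icc (0 : ℝ) T, 0 ≤ v t)
    (κ : ℝ → ℝ)
    (hκ_cont : ContinuousOn κ (Ici 0))
    (hκ_mono : MonotoneOn κ (Ici 0))
    (hκ_concave : ConcaveOn ℝ (Ici 0) κ)
    (hκ_nonneg : ∀ q ∈ Ici (0 : ℝ), 0 ≤ κ q)
    (hκ_pos : ∀ q > (0 : ℝ), 0 < κ q)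
    (hmain : ∀ t ∈ Icc (0 : ℝ) T, u t ≤ u₀ + ∫ s in (0 : ℝ)..t, v s * κ (u s))
    (hint : ENNReal.ofReal (∫ s in (0 : ℝ)..T, v s) ≤
      ∫⁻ q in Ioo u₀ ε, ENNReal.ofReal (1 / κ q)) :
    ∀ t ∈ Icc (0 : ℝ) T, u t ≤ ε := by
  intro t₁ ht₁
  by_contra! hlt
  set R : ℝ → ℝ := fun t => u₀ + ∫ s in (0 : ℝ)..t, v s * κ (u s)
  set V : ℝ → ℝ := fun t => ∫ s in (0 : ℝ)..t, v s
  have hf_cont : ContinuousOn (fun s => v s * κ (u s)) (Icc 0 T) :=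
    hv_cont.mul (hκ_cont.comp hu_cont hu_nonneg)
  have hf_nonneg : ∀ s ∈ Icc 0 T, 0 ≤ v s * κ (u s) := fun s hs =>
    mul_nonneg (hv_nonneg s hs) (hκ_nonneg _ (hu_nonneg s hs))
  have hR_cont : ContinuousOn R (Icc 0 T) :=
    continuousOn_const.add (continuousOn_primitive_of_continuousOn_Icc hT.le hf_cont)
  have hR_mono : MonotoneOn R (Icc 0 T) :=
    (monotoneOn_primitive_of_nonneg hT.le hf_cont hf_nonneg).const_add u₀
  have hV_cont : ContinuousOn V (Icc 0 T) :=
    continuousOn_primitive_of_continuousOn_Icc hT.le hv_cont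
  have hV_mono : MonotoneOn V (Icc 0 T) := monotoneOn_primitive_of_nonneg hT.le hv_cont hv_nonneg
  have hR_zero : R 0 = u₀ := by simp [R]
  have hV_zero : V 0 = 0 := by simp [V]
  have hεR : ε < R t₁ := hlt.trans_le (hmain t₁ ht₁)
  have hκ_cont' : ContinuousOn κ (Ioi 0) := hκ_cont.mono Ioi_subset_Ici_self
  have hbound : ∀ a ∈ Ioo u₀ ε, ∫ q in a..(R t₁), 1 / κ q ≤ V T := by
    intro a ha
    obtain ⟨s, hs, rfl⟩ := intermediate_value_Icc ht₁.1
      (hR_cont.mono (Icc_subset_Icc_right ht₁.2))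
      ⟨hR_zero.le.trans ha.1.le, (ha.2.trans hεR).le⟩
    have hsT : s ∈ Icc 0 T := ⟨hs.1, hs.2.trans ht₁.2⟩
    have hsub : Icc s t₁ ⊆ Icc 0 T := Icc_subset_Icc hs.1 ht₁.2
    have hIoo : Ioo s t₁ ⊆ Ioo 0 T := Ioo_subset_Ioo hs.1 ht₁.2
    have hpos : ∀ x ∈ Icc s t₁, 0 < R x := fun x hx =>
      (hu₀_nonneg.trans_lt ha.1).trans_le (hR_mono hsT (hsub hx) hx.1)
    have h := integral_one_div_le_of_hasDerivAt_le hs.2 (hR_cont.mono hsub) (hV_cont.mono hsub)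
      (fun x hx => (hasDerivAt_primitive_of_continuousOn_Icc hf_cont (hIoo hx)).const_add u₀)
      (fun x hx => hasDerivAt_primitive_of_continuousOn_Icc hv_cont (hIoo hx))
      hκ_cont' hκ_pos hpos (fun x hx => by
        have hx' := hsub (Ioo_subset_Icc_self hx)
        exact mul_le_mul_of_nonneg_left
          (hκ_mono (hu_nonneg x hx') (hpos x (Ioo_subset_Icc_self hx)).le (hmain x hx'))
          (hv_nonneg x hx'))
    have h₁ : V t₁ ≤ V T := hV_mono ht₁ (right_mem_Icc.2 hT.le) ht₁.2
    have h₂ : V 0 ≤ V s := hV_mono (left_mem_Icc.2 hT.le) hsT hs.1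
    linarith
  have hcont : ContinuousOn (fun q => 1 / κ q) (Ioi 0) :=
    continuousOn_const.div hκ_cont' fun q hq => (hκ_pos q hq).ne'
  have hii : ∀ a b : ℝ, 0 < a → a ≤ b → IntervalIntegrable (fun q => 1 / κ q) volume a b :=
    fun a b ha hab => (hcont.mono fun y hy => ha.trans_le hy.1).intervalIntegrable_of_Icc hab
  have hgap : 0 < ∫ q in ε..(R t₁), 1 / κ q :=
    intervalIntegral_pos_of_pos_on (hii _ _ hε hεR.le)
      (fun q hq => one_div_pos.2 (hκ_pos q (hε.trans hq.1))) hεR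
  have hsmall : ∀ a ∈ Ioo u₀ ε,
      0 ≤ ∫ q in a..ε, 1 / κ q ∧
        ∫ q in a..ε, 1 / κ q ≤ V T - ∫ q in ε..(R t₁), 1 / κ q := by
    intro a ha
    have ha₀ : 0 < a := hu₀_nonneg.trans_lt ha.1
    refine ⟨integral_nonneg ha.2.le fun q hq =>
      (one_div_pos.2 (hκ_pos q (ha₀.trans_le hq.1))).le, ?_⟩
    have h := hbound a ha
    rw [← integral_add_adjacent_intervals (hii a ε ha₀ ha.2.le) (hii _ _ hε hεR.le)] at h
    linarith
  have hle : ∫⁻ q in Ioo u₀ ε, ENNReal.ofReal (1 / κ q) ≤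
      ENNReal.ofReal (V T - ∫ q in ε..(R t₁), 1 / κ q) := by
    refine setLIntegral_Ioo_le_of_forall_Ioc_le hu₀ fun a ha => ?_
    have ha₀ : 0 < a := hu₀_nonneg.trans_lt ha.1
    rw [← ofReal_integral_eq_lintegral_ofReal (hii a ε ha₀ ha.2.le).1
      ((ae_restrict_mem measurableSet_Ioc).mono fun q hq =>
        (one_div_pos.2 (hκ_pos q (ha₀.trans hq.1))).le), ← integral_of_le ha.2.le]
    exact ENNReal.ofReal_le_ofReal (hsmall a ha).2
  obtain ⟨a, ha⟩ := exists_between hu₀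
  have h := (ENNReal.ofReal_le_ofReal_iff ((hsmall a ha).1.trans (hsmall a ha).2)).1
    (hint.trans hle)
  exact (sub_lt_self (V T) hgap).not_ge h
end

section
/- Let κ₁ : [0,∞) → [0,∞) be continuous and nondecreasing, let C₃ > 0 and T₁ > 0 be such that κ₁(C₃·t) ≤ C₃ for all t ∈ [0,T₁]. Define φ₁(t) = C₃·t and φ_{n+1}(t) = ∫₀ᵗ κ₁(φ_n(s)) ds for n ≥ 1. Then the pointwise limit φ(t) = lim_{n→∞} φ_n(t) = inf_n φ_n(t) exists for every t ∈ [0,T₁], and φ satisfies the integral equation φ(t) = ∫₀ᵗ κ₁(φ(s)) ds for all t ∈ [0,T₁]. -/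
open Set MeasureTheory intervalIntegral Filter

/-- The Picard-type iterates `φ₁(t) = C₃ t`, `φ_{n+1}(t) = ∫₀ᵗ κ₁(φ_n(s)) ds`.
Here `phi κ₁ C₃ n` denotes `φ_{n+1}`, so `phi κ₁ C₃ 0 = φ₁`. -/
noncomputable def phi (κ₁ : ℝ → ℝ) (C₃ : ℝ) : ℕ → ℝ → ℝ
  | 0 => fun t => C₃ * t
  | n + 1 => fun t => ∫ s in (0 : ℝ)..t, κ₁ (phi κ₁ C₃ n s)

/-- If `f` is continuous and nonnegative on `[0,T]`, then so is `κ ∘ f`. -/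
lemma continuousOn_comp_of_nonneg {κ f : ℝ → ℝ} {T : ℝ} (hκ : ContinuousOn κ (Ici 0))
    (hf : ContinuousOn f (Icc 0 T)) (hf0 : ∀ t ∈ Icc (0 : ℝ) T, 0 ≤ f t) :
    ContinuousOn (fun t => κ (f t)) (Icc 0 T) :=
  hκ.comp hf hf0

lemma intervalIntegrable_of_continuousOn_Icc {f : ℝ → ℝ} {T t : ℝ}
    (hf : ContinuousOn f (Icc 0 T)) (ht : t ∈ Icc (0 : ℝ) T) :
    IntervalIntegrable f volume 0 t :=
  (hf.mono (Icc_subset_Icc_right ht.2)).intervalIntegrable_of_Icc ht.1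

lemma phi_continuousOn_nonneg {κ : ℝ → ℝ} {C T : ℝ} (hκ : ContinuousOn κ (Ici 0))
    (hκ0 : ∀ q ∈ Ici (0 : ℝ), 0 ≤ κ q) (hC : 0 ≤ C) (hT : 0 ≤ T) (n : ℕ) :
    ContinuousOn (phi κ C n) (Icc 0 T) ∧ ∀ t ∈ Icc (0 : ℝ) T, 0 ≤ phi κ C n t := by
  induction n with
  | zero =>
    simp only [phi]
    exact ⟨by fun_prop, fun t ht => mul_nonneg hC ht.1⟩
  | succ n ih =>
    simp only [phi]
    have hint := intervalIntegrable_of_continuousOn_Icc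
      (continuousOn_comp_of_nonneg hκ ih.1 ih.2) (right_mem_Icc.2 hT)
    constructor
    · have h := continuousOn_primitive_interval' hint left_mem_uIcc
      rwa [uIcc_of_le hT] at h
    · intro t ht
      exact integral_nonneg ht.1 fun s hs => hκ0 _ (ih.2 s ⟨hs.1, hs.2.trans ht.2⟩)

lemma phi_succ_le {κ : ℝ → ℝ} {C T : ℝ} (hκ : ContinuousOn κ (Ici 0))
    (hmono : MonotoneOn κ (Ici 0)) (hκ0 : ∀ q ∈ Ici (0 : ℝ), 0 ≤ κ q) (hC : 0 ≤ C)
    (hT : 0 ≤ T) (hbound : ∀ t ∈ Icc (0 : ℝ) T, κ (C * t) ≤ C) (n : ℕ) :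
    ∀ t ∈ Icc (0 : ℝ) T, phi κ C (n + 1) t ≤ phi κ C n t := by
  have hphi := phi_continuousOn_nonneg hκ hκ0 hC hT
  have hint (n : ℕ) {t : ℝ} (ht : t ∈ Icc (0 : ℝ) T) :
      IntervalIntegrable (fun s => κ (phi κ C n s)) volume 0 t :=
    intervalIntegrable_of_continuousOn_Icc
      (continuousOn_comp_of_nonneg hκ (hphi n).1 (hphi n).2) ht
  induction n with
  | zero =>
    intro t ht
    calc phi κ C 1 t ≤ ∫ _ in (0 : ℝ)..t, C :=
          integral_mono_on ht.1 (hint 0 ht) intervalIntegrable_const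
            fun s hs => hbound s ⟨hs.1, hs.2.trans ht.2⟩
      _ = phi κ C 0 t := by simp [phi, mul_comm]
  | succ n ih =>
    intro t ht
    refine integral_mono_on ht.1 (hint (n + 1) ht) (hint n ht) fun s hs => ?_
    have hs' : s ∈ Icc (0 : ℝ) T := ⟨hs.1, hs.2.trans ht.2⟩
    exact hmono ((hphi (n + 1)).2 s hs') ((hphi n).2 s hs') (ih s hs')

/-- For every `t ∈ [0,T₁]`, the pointwise limit `φ(t) = lim_n φ_n(t) = inf_n φ_n(t)`
exists, and `φ` satisfies the integral equation `φ(t) = ∫₀ᵗ κ₁(φ(s)) ds`. -/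
theorem phi_limit_integral_equation
    (κ₁ : ℝ → ℝ)
    (hκ₁_cont : ContinuousOn κ₁ (Ici 0))
    (hκ₁_mono : MonotoneOn κ₁ (Ici 0))
    (hκ₁_nonneg : ∀ q ∈ Ici (0 : ℝ), 0 ≤ κ₁ q)
    (C₃ T₁ : ℝ) (hC₃ : 0 < C₃) (hT₁ : 0 < T₁)
    (hbound : ∀ t ∈ Icc (0 : ℝ) T₁, κ₁ (C₃ * t) ≤ C₃) :
    ∀ t ∈ Icc (0 : ℝ) T₁,
      Tendsto (fun n : ℕ => phi κ₁ C₃ n t) atTop (nhds (⨅ n : ℕ, phi κ₁ C₃ n t)) ∧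
      (⨅ n : ℕ, phi κ₁ C₃ n t) =
        ∫ s in (0 : ℝ)..t, κ₁ (⨅ n : ℕ, phi κ₁ C₃ n s) := by
  have hphi := phi_continuousOn_nonneg hκ₁_cont hκ₁_nonneg hC₃.le hT₁.le
  have hanti : ∀ t ∈ Icc (0 : ℝ) T₁, Antitone fun n => phi κ₁ C₃ n t := fun t ht =>
    antitone_nat_of_succ_le fun n =>
      phi_succ_le hκ₁_cont hκ₁_mono hκ₁_nonneg hC₃.le hT₁.le hbound n t ht
  have hlim : ∀ t ∈ Icc (0 : ℝ) T₁,
      Tendsto (fun n : ℕ => phi κ₁ C₃ n t) atTop (nhds (⨅ n : ℕ, phi κ₁ C₃ n t)) :=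
    fun t ht => tendsto_atTop_ciInf (hanti t ht) ⟨0, by rintro _ ⟨n, rfl⟩; exact (hphi n).2 t ht⟩
  intro t ht
  refine ⟨hlim t ht, ?_⟩
  refine tendsto_nhds_unique ((tendsto_add_atTop_iff_nat 1).2 (hlim t ht)) ?_
  have hmem : ∀ s ∈ uIoc 0 t, s ∈ Icc (0 : ℝ) T₁ := fun s hs => by
    rw [uIoc_of_le ht.1] at hs
    exact ⟨hs.1.le, hs.2.trans ht.2⟩
  refine tendsto_integral_filter_of_dominated_convergence (fun _ => C₃) ?_ ?_
    intervalIntegrable_const ?_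
  · refine Eventually.of_forall fun n => ?_
    exact (intervalIntegrable_of_continuousOn_Icc
      (continuousOn_comp_of_nonneg hκ₁_cont (hphi n).1 (hphi n).2)
      ht).def'.aestronglyMeasurable
  · refine Eventually.of_forall fun n => Eventually.of_forall fun s hs => ?_
    have hs' := hmem s hs
    rw [Real.norm_of_nonneg (hκ₁_nonneg _ ((hphi n).2 s hs'))]
    exact (hκ₁_mono ((hphi n).2 s hs') ((hphi 0).2 s hs') (hanti s hs' n.zero_le)).trans
      (hbound s hs')
  · refine Eventually.of_forall fun s hs => ?_
    have hs' := hmem s hs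
    have h0 : (⨅ n : ℕ, phi κ₁ C₃ n s) ∈ Ici (0 : ℝ) := le_ciInf fun n => (hphi n).2 s hs'
    exact (hκ₁_cont _ h0).tendsto.comp (tendsto_nhdsWithin_iff.2
      ⟨hlim s hs', Eventually.of_forall fun n => (hphi n).2 s hs'⟩)
end

section
/- Let κ₂ : [0,∞) → [0,∞) be continuous, nondecreasing, with κ₂(0) = 0, κ₂(q) > 0 for q > 0 and ∫₀₊ dq/κ₂(q) = ∞. Let (a_k)_{k≥0} be a nonincreasing sequence of nonnegative reals with a_k → 0 as k → ∞, and let C₅ > 0 and η > 0 be such that κ₂(4a₀ + C₅·t) ≤ C₅ for all t ∈ [0,η]. Define ψ₁(t) = 4a₁ + C₅·t and ψ_{k+1}(t) = 4a_{k+1} + ∫₀ᵗ κ₂(ψ_k(s)) ds for k ≥ 1. Then lim_{k→∞} ψ_k(t) = 0 for every t ∈ [0,η]. -/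
open Set MeasureTheory intervalIntegral Filter

/-- The iterates `ψ₁(t) = 4a₁ + C₅ t`, `ψ_{k+1}(t) = 4a_{k+1} + ∫₀ᵗ κ₂(ψ_k(s)) ds`.
Here `psi κ₂ a C₅ k` denotes `ψ_{k+1}`, so `psi κ₂ a C₅ 0 = ψ₁`. -/
noncomputable def psi (κ₂ : ℝ → ℝ) (a : ℕ → ℝ) (C₅ : ℝ) : ℕ → ℝ → ℝ
  | 0 => fun t => 4 * a 1 + C₅ * t
  | k + 1 => fun t => 4 * a (k + 2) + ∫ s in (0 : ℝ)..t, κ₂ (psi κ₂ a C₅ k s)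

/-- **Osgood's uniqueness criterion**: if `∫₀₊ dq / κ(q) = ∞`, the only nonnegative continuous
solution of `f(t) = ∫₀ᵗ κ(f(s)) ds` on `[0, T]` is zero. -/
theorem osgood_eq_zero {κ f : ℝ → ℝ} {T : ℝ} (hκ : Continuous κ)
    (hκ_nonneg : ∀ q, 0 ≤ κ q) (hκ_pos : ∀ q > (0 : ℝ), 0 < κ q)
    (hκ_int : ∀ ε > (0 : ℝ), ∫⁻ q in Ioo (0 : ℝ) ε, ENNReal.ofReal (1 / κ q) = ⊤)
    (hf : ContinuousOn f (Icc 0 T)) (hf_nonneg : ∀ t ∈ Icc (0 : ℝ) T, 0 ≤ f t)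
    (hf_eq : ∀ t ∈ Icc (0 : ℝ) T, f t = ∫ s in (0 : ℝ)..t, κ (f s)) :
    ∀ t ∈ Icc (0 : ℝ) T, f t = 0 := by
  intro t ht
  by_contra hne
  have hpos : 0 < f t := lt_of_le_of_ne (hf_nonneg t ht) (Ne.symm hne)
  have hκf : ContinuousOn (fun s => κ (f s)) (Icc 0 T) := hκ.comp_continuousOn hf
  have hint : ∀ u ∈ Icc (0 : ℝ) T, ∀ v ∈ Icc (0 : ℝ) T,
      IntervalIntegrable (fun s => κ (f s)) volume u v := fun u hu v hv =>
    (hκf.mono (uIcc_subset_Icc hu hv)).intervalIntegrable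
  have h0 : (0 : ℝ) ∈ Icc (0 : ℝ) T := ⟨le_rfl, ht.1.trans ht.2⟩
  have hf0 : f 0 = 0 := by simpa using hf_eq 0 h0
  have hmono : ∀ u ∈ Icc (0 : ℝ) T, ∀ v ∈ Icc (0 : ℝ) T, u ≤ v → f u ≤ f v := by
    intro u hu v hv huv
    rw [← sub_nonneg, hf_eq u hu, hf_eq v hv,
      integral_interval_sub_left (hint 0 h0 v hv) (hint 0 h0 u hu)]
    exact integral_nonneg huv fun s _ => hκ_nonneg _
  have hderiv : ∀ u ∈ Ioo (0 : ℝ) T, HasDerivAt f (κ (f u)) u := by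
    intro u hu
    have h := integral_hasDerivAt_right (hint 0 h0 u (Ioo_subset_Icc_self hu))
      ((hκf.mono Ioo_subset_Icc_self).stronglyMeasurableAtFilter isOpen_Ioo u hu)
      (hκf.continuousAt (Icc_mem_nhds hu.1 hu.2))
    refine h.congr_of_eventuallyEq ?_
    filter_upwards [Icc_mem_nhds hu.1 hu.2] with v hv using hf_eq v hv
  have hinv : ∀ x > (0 : ℝ), ContinuousOn (fun q => 1 / κ q) (Ici x) := fun x hx =>
    continuousOn_const.div hκ.continuousOn fun q hq => (hκ_pos q (hx.trans_le hq)).ne'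
  have hbd : ∀ x ∈ Ioc (0 : ℝ) (f t), ∫ q in Ioc x (f t), ‖1 / κ q‖ ≤ t := by
    intro x hx
    obtain ⟨s, hs, rfl⟩ := intermediate_value_Icc ht.1
      (hf.mono (Icc_subset_Icc_right ht.2)) (show x ∈ Icc (f 0) (f t) from ⟨hf0.trans_le hx.1.le, hx.2⟩)
    have hsT : s ∈ Icc (0 : ℝ) T := ⟨hs.1, hs.2.trans ht.2⟩
    have hsub : uIcc s t ⊆ Icc 0 T := uIcc_subset_Icc hsT ht
    have hge : ∀ u ∈ uIcc s t, f s ≤ f u := fun u hu =>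
      hmono s hsT u (hsub hu) (uIcc_of_le hs.2 ▸ hu).1
    have key := integral_comp_mul_deriv'' (a := s) (b := t) (f := f) (f' := fun u => κ (f u))
      (g := fun q => 1 / κ q) (hf.mono hsub)
      (fun u hu => by
        rw [min_eq_left hs.2, max_eq_right hs.2] at hu
        exact (hderiv u ⟨hs.1.trans_lt hu.1, hu.2.trans_le ht.2⟩).hasDerivWithinAt)
      (hκf.mono hsub)
      ((hinv (f s) hx.1).mono (by rintro _ ⟨u, hu, rfl⟩; exact hge u hu))
    have hone : ∫ u in s..t, ((fun q => 1 / κ q) ∘ f) u * κ (f u) = ∫ u in s..t, (1 : ℝ) :=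
      integral_congr fun u hu =>
        one_div_mul_cancel (hκ_pos _ (hx.1.trans_le (hge u hu))).ne'
    rw [hone, integral_of_le hx.2] at key
    have hnorm : ∀ q, ‖1 / κ q‖ = 1 / κ q := fun q =>
      Real.norm_of_nonneg (one_div_nonneg.2 (hκ_nonneg q))
    simp only [hnorm, ← key, intervalIntegral.integral_const, smul_eq_mul, mul_one]
    linarith [hs.1]
  have hseq : ∀ n : ℕ, f t / (n + 1 : ℝ) ∈ Ioc (0 : ℝ) (f t) := fun n =>
    ⟨by positivity, div_le_self hpos.le (by linarith [n.cast_nonneg (α := ℝ)])⟩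
  have hI : IntegrableOn (fun q => 1 / κ q) (Ioc 0 (f t)) :=
    integrableOn_Ioc_of_intervalIntegral_norm_bounded_left (l := atTop)
      (a := fun n : ℕ => f t / (n + 1 : ℝ)) (I := t)
      (fun n => (((hinv _ (hseq n).1).mono Icc_subset_Ici_self).integrableOn_Icc).mono_set
        Ioc_subset_Icc_self)
      (by simpa [div_eq_mul_inv] using
        (tendsto_one_div_add_atTop_nhds_zero_nat (𝕜 := ℝ)).const_mul (f t))
      (Eventually.of_forall fun n => hbd _ (hseq n))
  exact (hI.mono_set Ioo_subset_Ioc_self).lintegral_lt_top.ne (hκ_int _ hpos)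

theorem psi_nonneg {κ : ℝ → ℝ} {a : ℕ → ℝ} {C : ℝ} (hκ : ∀ q, 0 ≤ q → 0 ≤ κ q)
    (ha : ∀ k, 0 ≤ a k) (hC : 0 ≤ C) (k : ℕ) {t : ℝ} (ht : 0 ≤ t) :
    0 ≤ psi κ a C k t := by
  induction k generalizing t with
  | zero => have := ha 1; simp only [psi]; positivity
  | succ k ih =>
    have := ha (k + 2)
    have : 0 ≤ ∫ s in (0 : ℝ)..t, κ (psi κ a C k s) :=
      integral_nonneg ht fun s hs => hκ _ (ih hs.1)
    simp only [psi]; positivity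

theorem psi_congr {κ κ' : ℝ → ℝ} {a : ℕ → ℝ} {C : ℝ} (hκ : ∀ q, 0 ≤ q → 0 ≤ κ q)
    (h : ∀ q, 0 ≤ q → κ' q = κ q) (ha : ∀ k, 0 ≤ a k) (hC : 0 ≤ C) (k : ℕ) {t : ℝ}
    (ht : 0 ≤ t) : psi κ' a C k t = psi κ a C k t := by
  induction k generalizing t with
  | zero => rfl
  | succ k ih =>
    simp only [psi]
    congr 1
    refine integral_congr fun s hs => ?_
    rw [uIcc_of_le ht] at hs
    simp only [ih hs.1, h _ (psi_nonneg hκ ha hC k hs.1)]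

theorem continuous_psi {κ : ℝ → ℝ} (hκ : Continuous κ) (a : ℕ → ℝ) (C : ℝ) (k : ℕ) :
    Continuous (psi κ a C k) := by
  induction k with
  | zero => simp only [psi]; fun_prop
  | succ k ih =>
    exact continuous_const.add
      (continuous_primitive (fun u v => (hκ.comp ih).intervalIntegrable u v) 0)

theorem psi_succ_le {κ : ℝ → ℝ} {a : ℕ → ℝ} {C η : ℝ} (hκ : Continuous κ) (hmono : Monotone κ)
    (ha : Antitone a) (hbound : ∀ t ∈ Icc (0 : ℝ) η, κ (4 * a 0 + C * t) ≤ C) (k : ℕ) {t : ℝ}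
    (ht : t ∈ Icc (0 : ℝ) η) : psi κ a C (k + 1) t ≤ psi κ a C k t := by
  have hint : ∀ j r, IntervalIntegrable (fun s => κ (psi κ a C j s)) volume 0 r := fun j r =>
    (hκ.comp (continuous_psi hκ a C j)).intervalIntegrable 0 r
  induction k generalizing t with
  | zero =>
    have h : ∫ s in (0 : ℝ)..t, κ (psi κ a C 0 s) ≤ ∫ s in (0 : ℝ)..t, C :=
      integral_mono_on ht.1 (hint 0 t) intervalIntegrable_const fun s hs =>
        (hmono (by simp only [psi]; linarith [ha zero_le_one])).trans
          (hbound s ⟨hs.1, hs.2.trans ht.2⟩)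
    rw [intervalIntegral.integral_const, smul_eq_mul, sub_zero, mul_comm] at h
    exact add_le_add (mul_le_mul_of_nonneg_left (ha one_le_two) (by norm_num)) h
  | succ k ih =>
    exact add_le_add (mul_le_mul_of_nonneg_left (ha (Nat.le_succ (k + 2))) (by norm_num))
      (integral_mono_on ht.1 (hint (k + 1) t) (hint k t) fun s hs =>
        hmono (ih ⟨hs.1, hs.2.trans ht.2⟩))

/-- The limit of the iterates for a globally continuous and monotone `κ`. -/
theorem psi_tendsto_zero_of_continuous {κ : ℝ → ℝ} {a : ℕ → ℝ} {C η : ℝ} (hκ : Continuous κ)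
    (hmono : Monotone κ) (hκ_nonneg : ∀ q, 0 ≤ κ q) (hκ_pos : ∀ q > (0 : ℝ), 0 < κ q)
    (hκ_int : ∀ ε > (0 : ℝ), ∫⁻ q in Ioo (0 : ℝ) ε, ENNReal.ofReal (1 / κ q) = ⊤)
    (ha : Antitone a) (ha_nonneg : ∀ k, 0 ≤ a k) (ha_lim : Tendsto a atTop (nhds 0))
    (hC : 0 ≤ C) (hbound : ∀ t ∈ Icc (0 : ℝ) η, κ (4 * a 0 + C * t) ≤ C) :
    ∀ t ∈ Icc (0 : ℝ) η, Tendsto (fun k => psi κ a C k t) atTop (nhds 0) := by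
  have hnn : ∀ k, ∀ t ∈ Icc (0 : ℝ) η, 0 ≤ psi κ a C k t := fun k t ht =>
    psi_nonneg (fun q _ => hκ_nonneg q) ha_nonneg hC k ht.1
  have hanti : ∀ t ∈ Icc (0 : ℝ) η, Antitone fun k => psi κ a C k t := fun t ht =>
    antitone_nat_of_succ_le fun k => psi_succ_le hκ hmono ha hbound k ht
  set φ : ℝ → ℝ := fun t => ⨅ k, psi κ a C k t with hφ
  have hlim : ∀ t ∈ Icc (0 : ℝ) η, Tendsto (fun k => psi κ a C k t) atTop (nhds (φ t)) :=
    fun t ht => tendsto_atTop_ciInf (hanti t ht)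
      ⟨0, by rintro _ ⟨k, rfl⟩; exact hnn k t ht⟩
  have hle : ∀ k, ∀ t ∈ Icc (0 : ℝ) η, ‖κ (psi κ a C k t)‖ ≤ C := fun k t ht => by
    rw [Real.norm_of_nonneg (hκ_nonneg _)]
    refine (hmono ((hanti t ht (Nat.zero_le k)).trans ?_)).trans (hbound t ht)
    simp only [psi]
    linarith [ha zero_le_one]
  have hκlim : ∀ t ∈ Icc (0 : ℝ) η,
      Tendsto (fun k => κ (psi κ a C k t)) atTop (nhds (κ (φ t))) := fun t ht =>
    (hκ.tendsto _).comp (hlim t ht)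
  have heq : ∀ t ∈ Icc (0 : ℝ) η, φ t = ∫ s in (0 : ℝ)..t, κ (φ s) := by
    intro t ht
    have hsub : uIoc 0 t ⊆ Icc 0 η := by
      rw [uIoc_of_le ht.1]
      exact fun s hs => ⟨hs.1.le, hs.2.trans ht.2⟩
    have h := tendsto_integral_filter_of_dominated_convergence (μ := volume) (a := 0) (b := t)
      (l := atTop) (F := fun k s => κ (psi κ a C k s)) (f := fun s => κ (φ s)) (fun _ => C)
      (Eventually.of_forall fun k =>
        (hκ.comp (continuous_psi hκ a C k)).aestronglyMeasurable)
      (Eventually.of_forall fun k => Eventually.of_forall fun s hs => hle k s (hsub hs))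
      intervalIntegrable_const
      (Eventually.of_forall fun s hs => hκlim s (hsub hs))
    have h4 := ((ha_lim.comp (tendsto_add_atTop_nat 2)).const_mul 4).add h
    rw [mul_zero, zero_add] at h4
    exact tendsto_nhds_unique ((hlim t ht).comp (tendsto_add_atTop_nat 1)) h4
  have hφ_meas : Measurable φ := Measurable.iInf fun k => (continuous_psi hκ a C k).measurable
  have hφ_int : IntegrableOn (fun s => κ (φ s)) (Icc 0 η) :=
    Measure.integrableOn_of_bounded (M := C) measure_Icc_lt_top.ne
      (hκ.measurable.comp hφ_meas).aestronglyMeasurable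
      ((ae_restrict_iff' measurableSet_Icc).2 (Eventually.of_forall fun s hs =>
        le_of_tendsto' (hκlim s hs).norm fun k => hle k s hs))
  have hφ_cont : ContinuousOn φ (Icc 0 η) := by
    rcases le_or_gt 0 η with hη | hη
    · have h := continuousOn_primitive_interval (a := 0) (b := η) (μ := volume)
        (f := fun s => κ (φ s)) (by rwa [uIcc_of_le hη])
      rw [uIcc_of_le hη] at h
      exact h.congr heq
    · simp [Icc_eq_empty hη.not_ge]
  intro t ht
  have hzero := osgood_eq_zero hκ hκ_nonneg hκ_pos hκ_int hφ_cont
    (fun s hs => ge_of_tendsto' (hlim s hs) fun k => hnn k s hs) heq t ht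
  exact hzero ▸ hlim t ht

/-- If `κ₂(0) = 0`, `κ₂(q) > 0` for `q > 0`, `∫₀₊ dq/κ₂(q) = ∞`, and `a_k → 0`,
then `ψ_k(t) → 0` as `k → ∞`, for every `t ∈ [0,η]`. -/
theorem psi_tendsto_zero
    (κ₂ : ℝ → ℝ)
    (hκ₂_cont : ContinuousOn κ₂ (Ici 0))
    (hκ₂_mono : MonotoneOn κ₂ (Ici 0))
    (hκ₂0 : κ₂ 0 = 0)
    (hκ₂_pos : ∀ q > (0 : ℝ), 0 < κ₂ q)
    (hκ₂_int : ∀ ε > (0 : ℝ), ∫⁻ q in Ioo (0 : ℝ) ε, ENNReal.ofReal (1 / κ₂ q) = ⊤)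
    (a : ℕ → ℝ) (ha_anti : Antitone a) (ha_nonneg : ∀ k, 0 ≤ a k)
    (ha_lim : Tendsto a atTop (nhds 0))
    (C₅ η : ℝ) (hC₅ : 0 < C₅) (hη : 0 < η)
    (hbound : ∀ t ∈ Icc (0 : ℝ) η, κ₂ (4 * a 0 + C₅ * t) ≤ C₅) :
    ∀ t ∈ Icc (0 : ℝ) η,
      Tendsto (fun k : ℕ => psi κ₂ a C₅ k t) atTop (nhds 0) := by
  have hnn : ∀ q, 0 ≤ q → 0 ≤ κ₂ q := fun q hq =>
    hκ₂0 ▸ hκ₂_mono self_mem_Ici hq hq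
  have hext : ∀ q, 0 ≤ q → κ₂ (max q 0) = κ₂ q := fun q hq => by rw [max_eq_left hq]
  have ha0 := ha_nonneg 0
  intro t ht
  refine (psi_tendsto_zero_of_continuous (κ := fun q => κ₂ (max q 0))
    (hκ₂_cont.comp_continuous (by fun_prop) fun q => le_max_right q 0)
    (fun p q hpq => hκ₂_mono (le_max_right p 0) (le_max_right q 0) (max_le_max_right 0 hpq))
    (fun q => hnn _ (le_max_right q 0))
    (fun q hq => by simpa only [hext q hq.le] using hκ₂_pos q hq)
    (fun ε hε => ?_) ha_anti ha_nonneg ha_lim hC₅.le (fun s hs => ?_) t ht).congr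
    fun k => psi_congr hnn hext ha_nonneg hC₅.le k ht.1
  · rw [← hκ₂_int ε hε]
    exact setLIntegral_congr_fun measurableSet_Ioo fun q hq => by simp only [hext q hq.1.le]
  · have := hs.1
    rw [hext _ (by positivity)]
    exact hbound s hs
end
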